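/- For every n and every x ∈ 2^n: K(x|n) = k_x + K(x|Ω^{n,k_x}, n) up to an additive error of at most 2 log k_x + O(1). -/

import Mathlib

open scoped BigOperators
open scoped Classical

/-- The standard bijection between natural numbers and finite binary strings
(`ε ↦ 0`, `0 ↦ 1`, `1 ↦ 2`, `00 ↦ 3`, ...), inverse direction. -/
def strOfNat (n : ℕ) : List Bool := (n + 1).bits.dropLast

/-- Base-2 tetration: `1, 2, 2^2, 2^(2^2), ...`. -/
def tetr : ℕ → ℕ
  | 0 => 1
  | k + 1 => 2 ^ tetr k

/-- The super-logarithm, the inverse of base-2 tetration. -/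
noncomputable def slog (x : ℕ) : ℕ := sSup {k | tetr k ≤ x}

noncomputable section

/-- A machine given by a computable, monotone (in time) stepwise evaluation function
`step t p y n` : time `t`, program `p`, condition `y`, length parameter `n`
(the length parameter is always available). -/
structure Machine where
  step : ℕ → List Bool → ℕ → ℕ → Option ℕ
  computable_step :
    Computable fun q : (ℕ × List Bool) × ℕ × ℕ => step q.1.1 q.1.2 q.2.1 q.2.2
  mono : ∀ {t t' : ℕ} {p : List Bool} {y n v : ℕ}, t ≤ t' →
      step t p y n = some v → step t' p y n = some v

namespace Machine

variable (M : Machine)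

/-- `M(p|y,n) ↓ = v`. -/
def Outputs (p : List Bool) (y n v : ℕ) : Prop := ∃ t, M.step t p y n = some v

/-- `M(p|y,n) ↓`. -/
def HaltsOn (p : List Bool) (y n : ℕ) : Prop := ∃ v, M.Outputs p y n v

/-- the domain of `M` is prefix-free (for every condition). -/
def PrefixFree : Prop :=
  ∀ {p q : List Bool} {y n : ℕ}, M.HaltsOn p y n → M.HaltsOn q y n → p <+: q → p = q

/-- Kolmogorov complexity with respect to `M` (prefix-free complexity `K` when `M` is an
optimal prefix-free interpreter, plain complexity `C` when `M` is an optimal plain machine). -/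
def C (x y n : ℕ) : ℕ := sInf {l | ∃ p : List Bool, p.length = l ∧ M.Outputs p y n x}

/-- Time-bounded Kolmogorov complexity (`⊤` if no program produces `x` within time `t`). -/
def Ct (t x y n : ℕ) : ℕ∞ :=
  sInf {l : ℕ∞ | ∃ p : List Bool, (p.length : ℕ∞) = l ∧ M.step t p y n = some x}

/-- every value has a program, for every condition. -/
def Total : Prop := ∀ x y n, ∃ p : List Bool, M.Outputs p y n x

/-- `M` is an optimal universal prefix-free interpreter. -/
def POptimal : Prop := M.PrefixFree ∧ M.Total ∧
  ∀ N : Machine, N.PrefixFree → ∃ c, ∀ (p : List Bool) (y n v : ℕ),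
    N.Outputs p y n v → M.C v y n ≤ p.length + c

/-- `M` is an optimal universal plain machine. -/
def Optimal : Prop := M.Total ∧
  ∀ N : Machine, ∃ c, ∀ (p : List Bool) (y n v : ℕ),
    N.Outputs p y n v → M.C v y n ≤ p.length + c

/-- `p` is a shortest program for `x` (given `y`, `n`) on `M`. -/
def ShortestProg (p : List Bool) (x y n : ℕ) : Prop :=
  M.Outputs p y n x ∧ p.length = M.C x y n

/-- `u → v`: some program of length at most `c` computes `v` from `u` (and `n`). -/
def Computes (c u n v : ℕ) : Prop := ∃ q : List Bool, q.length ≤ c ∧ M.Outputs q u n v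

/-- `Ω^n_t`. -/
def OmegaT (n t : ℕ) : ℝ :=
  ∑' p : List Bool,
    if ∃ v, v < 2 ^ n ∧ M.step t p 0 n = some v then (2 : ℝ) ^ (-(p.length : ℤ)) else 0

/-- `Ω^n`. -/
def Omega (n : ℕ) : ℝ :=
  ∑' p : List Bool,
    if ∃ v, v < 2 ^ n ∧ M.Outputs p 0 n v then (2 : ℝ) ^ (-(p.length : ℤ)) else 0

/-- `t_k = min { t : Ω^n − Ω^n_t ≤ 2^{−k} }`. -/
def tk (n k : ℕ) : ℕ := sInf {t | M.Omega n - M.OmegaT n t ≤ (2 : ℝ) ^ (-(k : ℤ))}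

/-- the computational `m`-depth `k_x` of `x ∈ 2^n`, with additive constant `d`:
`k_x = min { k : K_{t_k}(x) ≤ K(x) + d }`. -/
def mdepth (d n x : ℕ) : ℕ :=
  sInf {k | ∃ p : List Bool, p.length ≤ M.C x 0 n + d ∧ M.step (M.tk n k) p 0 n = some x}

/-- `Ω^{n,j}`: the first `j` bits of the binary expansion of `Ω^n`, as a natural number. -/
def OmegaBits (n j : ℕ) : ℕ := ⌊M.Omega n * 2 ^ j⌋₊

/-- `H^{n,j}`: the first `j` bits of the Halting sequence `H^n` of `M`, as a natural number. -/
def Hbits (n j : ℕ) : ℕ :=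
  ∑ i ∈ Finset.range j, if M.HaltsOn (strOfNat i) 0 n then 2 ^ i else 0

/-- The Busy Beaver function of `M`: `BB(k) = max { M(p) : p ∈ 2^k, M(p)↓ }`. -/
def BB (n k : ℕ) : ℕ := sSup {v | ∃ p : List Bool, p.length = k ∧ M.Outputs p 0 n v}

end Machine

/-- `p` is a program on `M` computing the rational-valued function `P`. -/
def ProgForProb (M : Machine) (p : List Bool) (P : ℕ → ℚ) (n : ℕ) : Prop :=
  ∀ y, M.Outputs p y n (Encodable.encode (P y))

/-- Complexity of the function `P` with respect to `M`. -/
noncomputable def KProb (M : Machine) (n : ℕ) (P : ℕ → ℚ) : ℕ :=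
  sInf {l | ∃ p : List Bool, p.length = l ∧ ProgForProb M p P n}

/-- a (length conditional) semimeasure on `2^n`. -/
def IsSemimeasure (n : ℕ) (P : ℕ → ℚ) : Prop :=
  (∀ y, 0 ≤ P y) ∧ ∑ y ∈ Finset.range (2 ^ n), P y ≤ 1

/-- `p` is a program on `M` computing the partial function `F` (on binary strings). -/
def ProgForFun (M : Machine) (p : List Bool) (F : List Bool → Option ℕ) (n : ℕ) : Prop :=
  ∀ d v, F d = some v ↔ M.Outputs p (Encodable.encode d) n v

/-- `F` has prefix-free domain. -/
def PrefixFreeFun (F : List Bool → Option ℕ) : Prop :=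
  ∀ d d', (F d).isSome → (F d').isSome → d <+: d' → d = d'

/-- Complexity of the partial function `F` with respect to `M`. -/
noncomputable def KFun (M : Machine) (n : ℕ) (F : List Bool → Option ℕ) : ℕ :=
  sInf {l | ∃ p : List Bool, p.length = l ∧ ProgForFun M p F n}

/-- sufficient set statistic: `x ∈ S` and `K(S) + log|S| = K(x) ± c`. -/
def SufficientSet (Φ : Machine) (c n x : ℕ) (S : Finset ℕ) : Prop :=
  x ∈ S ∧ S ⊆ Finset.range (2 ^ n) ∧
    Nat.dist (Φ.C (Encodable.encode S) 0 n + Nat.log 2 S.card) (Φ.C x 0 n) ≤ c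

/-- sufficient probabilistic statistic: `P` computable semimeasure, `K(P) − log P(x) = K(x) ± c`. -/
def SufficientProb (Φ : Machine) (c n x : ℕ) (P : ℕ → ℚ) : Prop :=
  IsSemimeasure n P ∧ (∃ p, ProgForProb Φ p P n) ∧
    |(KProb Φ n P : ℝ) - Real.logb 2 (P x) - (Φ.C x 0 n : ℝ)| ≤ c

/-- sufficient function statistic: `F` computable prefix-free,
`K(F) + l(d) = K(x) ± c` for some `d` with `F(d) = x`. -/
def SufficientFun (Φ : Machine) (c n x : ℕ) (F : List Bool → Option ℕ) : Prop :=
  PrefixFreeFun F ∧ (∃ p, ProgForFun Φ p F n) ∧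
    ∃ d, F d = some x ∧ Nat.dist (KFun Φ n F + d.length) (Φ.C x 0 n) ≤ c

/-- minimal sufficient set statistic (within the constant `c`). -/
def MinimalSufficientSet (Φ : Machine) (c n x : ℕ) (S : Finset ℕ) : Prop :=
  SufficientSet Φ c n x S ∧ ∀ S' : Finset ℕ, SufficientSet Φ c n x S' →
    Φ.C (Encodable.encode S) 0 n ≤ Φ.C (Encodable.encode S') 0 n + c

/-- `l^S_x`: the complexity of a minimal sufficient set statistic. -/
noncomputable def lSet (Φ : Machine) (c n x : ℕ) : ℕ :=
  sInf {l | ∃ S : Finset ℕ, SufficientSet Φ c n x S ∧ Φ.C (Encodable.encode S) 0 n = l}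

/-- `l^P_x`: the complexity of a minimal sufficient probabilistic statistic. -/
noncomputable def lProb (Φ : Machine) (c n x : ℕ) : ℕ :=
  sInf {l | ∃ P : ℕ → ℚ, SufficientProb Φ c n x P ∧ KProb Φ n P = l}

/-- `l^F_x`: the complexity of a minimal sufficient function statistic. -/
noncomputable def lFun (Φ : Machine) (c n x : ℕ) : ℕ :=
  sInf {l | ∃ F : List Bool → Option ℕ, SufficientFun Φ c n x F ∧ KFun Φ n F = l}

/-- weak sufficient set statistic: `C(S) + log|S| = K(x|C(S)) ± c`
(`Φ` the prefix-free interpreter, `Ψ` the plain machine). -/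
def WeakSufficientSet (Φ Ψ : Machine) (c n x : ℕ) (S : Finset ℕ) : Prop :=
  x ∈ S ∧ S ⊆ Finset.range (2 ^ n) ∧
    Nat.dist (Ψ.C (Encodable.encode S) 0 n + Nat.log 2 S.card)
      (Φ.C x (Ψ.C (Encodable.encode S) 0 n) n) ≤ c

/-- weak sufficient probabilistic statistic: `C(P) − log P(x) = K(x|C(P)) ± c`. -/
def WeakSufficientProb (Φ Ψ : Machine) (c n x : ℕ) (P : ℕ → ℚ) : Prop :=
  IsSemimeasure n P ∧ (∃ p, ProgForProb Ψ p P n) ∧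
    |(KProb Ψ n P : ℝ) - Real.logb 2 (P x) - (Φ.C x (KProb Ψ n P) n : ℝ)| ≤ c

/-- weak sufficient function statistic: `C(F) + l(d) = K(x|C(F)) ± c` for some `d`, `F(d) = x`. -/
def WeakSufficientFun (Φ Ψ : Machine) (c n x : ℕ) (F : List Bool → Option ℕ) : Prop :=
  (∃ p, ProgForFun Ψ p F n) ∧
    ∃ d, F d = some x ∧ Nat.dist (KFun Ψ n F + d.length) (Φ.C x (KFun Ψ n F) n) ≤ c

/-- typical semimeasure: `−log P(x) = K(x|P*) ± c`, `P*` a shortest plain description of `P`. -/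
def TypicalProb (Φ Ψ : Machine) (c n x : ℕ) (P : ℕ → ℚ) : Prop :=
  IsSemimeasure n P ∧ (∃ p, ProgForProb Ψ p P n) ∧
    ∀ p : List Bool, ProgForProb Ψ p P n → p.length = KProb Ψ n P →
      |(-Real.logb 2 (P x)) - (Φ.C x (Encodable.encode p) n : ℝ)| ≤ c

/-- the `BB`-depth `k'_x` with additive constant `d`:
`k'_x = min { k : K_{BB(k)}(x|k) ≤ K(x|k) + d }`. -/
noncomputable def kBB (Φ Ψ : Machine) (d n x : ℕ) : ℕ :=
  sInf {k | ∃ p : List Bool, p.length ≤ Φ.C x k n + d ∧ Φ.step (Ψ.BB n k) p k n = some x}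

/-- The explicit weak sufficient statistic `P'_x`, with constants `d` (for `k'_x`),
`c` (scaling) and `c₂` (difference threshold):
`P'_x(y) = 2^{−K_{BB(k'_x)}(y|k'_x) + k'_x − c}` when
`K_{BB(k'_x)}(y|k'_x)` and `K_{BB(k'_x−1)}(y|k'_x)` differ by more than `c₂`, else `0`. -/
noncomputable def Pprime (Φ Ψ : Machine) (d c c₂ n x : ℕ) (y : ℕ) : ℚ :=
  if Φ.Ct (Ψ.BB n (kBB Φ Ψ d n x)) y (kBB Φ Ψ d n x) n + (c₂ : ℕ∞) <
      Φ.Ct (Ψ.BB n (kBB Φ Ψ d n x - 1)) y (kBB Φ Ψ d n x) n then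
    (2 : ℚ) ^ (kBB Φ Ψ d n x) /
      2 ^ (c + (Φ.Ct (Ψ.BB n (kBB Φ Ψ d n x)) y (kBB Φ Ψ d n x) n).toNat)
  else 0

/-- A prefix-free oracle machine: `step t p y n w` where `w` is the length-`t` initial
segment of the oracle which may be queried within `t` steps. -/
structure OracleMachine where
  step : ℕ → List Bool → ℕ → ℕ → List Bool → Option ℕ
  computable_step :
    Computable fun q : ((ℕ × List Bool) × ℕ × ℕ) × List Bool =>
      step q.1.1.1 q.1.1.2 q.1.2.1 q.1.2.2 q.2
  mono : ∀ {t t' : ℕ} {p : List Bool} {y n v : ℕ} (O : ℕ → Bool), t ≤ t' →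
      step t p y n (List.ofFn fun i : Fin t => O i) = some v →
      step t' p y n (List.ofFn fun i : Fin t' => O i) = some v

namespace OracleMachine

variable (M : OracleMachine) (O : ℕ → Bool)

def Outputs (p : List Bool) (y n v : ℕ) : Prop :=
  ∃ t, M.step t p y n (List.ofFn fun i : Fin t => O i) = some v

def HaltsOn (p : List Bool) (y n : ℕ) : Prop := ∃ v, M.Outputs O p y n v

def PrefixFree : Prop :=
  ∀ {p q : List Bool} {y n : ℕ}, M.HaltsOn O p y n → M.HaltsOn O q y n → p <+: q → p = q

/-- oracle Kolmogorov complexity `K^O`. -/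
def C (x y n : ℕ) : ℕ := sInf {l | ∃ p : List Bool, p.length = l ∧ M.Outputs O p y n x}

def Total : Prop := ∀ x y n, ∃ p : List Bool, M.Outputs O p y n x

/-- `M` is an optimal universal prefix-free machine relative to the oracle `O`. -/
def POptimal : Prop := M.PrefixFree O ∧ M.Total O ∧
  ∀ N : OracleMachine, N.PrefixFree O → ∃ c, ∀ (p : List Bool) (y n v : ℕ),
    N.Outputs O p y n v → M.C O v y n ≤ p.length + c

end OracleMachine

/-- The Halting sequence of `Φ` as a single oracle (pairing index and length parameter). -/
noncomputable def Hseq (Φ : Machine) : ℕ → Bool :=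
  fun i => decide (Φ.HaltsOn (strOfNat i.unpair.1) 0 i.unpair.2)

end

section Auxiliary

open scoped ENNReal

/-! ### Computability -/

theorem computable_pow : Computable₂ ((· ^ ·) : ℕ → ℕ → ℕ) :=
  (Primrec₂.unpaired'.1 Nat.Primrec.pow).to_comp

theorem Computable.add {α : Type*} [Primcodable α] {f g : α → ℕ} (hf : Computable f)
    (hg : Computable g) : Computable fun a => f a + g a :=
  Primrec.nat_add.to_comp.comp hf hg

theorem Computable.sub {α : Type*} [Primcodable α] {f g : α → ℕ} (hf : Computable f)
    (hg : Computable g) : Computable fun a => f a - g a :=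
  Primrec.nat_sub.to_comp.comp hf hg

theorem Computable.mul {α : Type*} [Primcodable α] {f g : α → ℕ} (hf : Computable f)
    (hg : Computable g) : Computable fun a => f a * g a :=
  Primrec.nat_mul.to_comp.comp hf hg

theorem Computable.two_pow {α : Type*} [Primcodable α] {f : α → ℕ} (hf : Computable f) :
    Computable fun a => 2 ^ f a :=
  computable_pow.comp (Computable.const 2) hf

theorem Computable.le {α : Type*} [Primcodable α] {f g : α → ℕ} (hf : Computable f)
    (hg : Computable g) : Computable fun a => decide (f a ≤ g a) :=
  Primrec.nat_le.decide.to_comp.comp hf hg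

theorem Computable.band {α : Type*} [Primcodable α] {f g : α → Bool} (hf : Computable f)
    (hg : Computable g) : Computable fun a => f a && g a :=
  Primrec.and.to_comp.comp hf hg

theorem Computable.bnot {α : Type*} [Primcodable α] {f : α → Bool} (hf : Computable f) :
    Computable fun a => !f a :=
  Primrec.not.to_comp.comp hf

/-- `some a` if the test `b` succeeds, `none` otherwise. -/
def guardSome {α : Type*} (b : Bool) (a : α) : Option α := bif b then some a else none

theorem guardSome_eq_some {α : Type*} {b : Bool} {a a' : α} :
    guardSome b a = some a' ↔ b = true ∧ a = a' := by
  cases b <;> simp [guardSome]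

theorem Computable.guardSome {α β : Type*} [Primcodable α] [Primcodable β] {b : α → Bool}
    {f : α → β} (hb : Computable b) (hf : Computable f) :
    Computable fun a => guardSome (b a) (f a) :=
  Computable.cond hb (Computable.option_some.comp hf) (Computable.const none)

/-! ### Binary strings as dyadic intervals -/

/-- The number with binary expansion `p`, most significant digit first. -/
def bitsVal (p : List Bool) : ℕ := p.foldl (fun a b => 2 * a + b.toNat) 0

theorem computable_bitsVal : Computable bitsVal := by
  have h : Primrec bitsVal := by
    refine Primrec.list_foldl (h := fun (_ : List Bool) (q : ℕ × Bool) => 2 * q.1 + q.2.toNat)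
      Primrec.id (Primrec.const 0) ?_
    refine Primrec.nat_add.comp (Primrec.nat_mul.comp (Primrec.const 2)
      (Primrec.fst.comp Primrec.snd)) ?_
    exact (Primrec.dom_bool Bool.toNat).comp (Primrec.snd.comp Primrec.snd)
  exact h.to_comp

theorem bitsVal_concat (p : List Bool) (b : Bool) : bitsVal (p ++ [b]) = 2 * bitsVal p + b.toNat := by
  simp [bitsVal]

theorem bitsVal_append_bounds (p q : List Bool) :
    bitsVal p * 2 ^ q.length ≤ bitsVal (p ++ q) ∧
      bitsVal (p ++ q) + 1 ≤ (bitsVal p + 1) * 2 ^ q.length := by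
  induction q using List.reverseRecOn with
  | nil => simp
  | append_singleton q b ih =>
    rw [← List.append_assoc, bitsVal_concat, List.length_append, List.length_singleton, pow_succ]
    have : b.toNat ≤ 1 := Bool.toNat_le b
    constructor <;> nlinarith [ih.1, ih.2]

theorem exists_bitsVal_eq (l a : ℕ) (ha : a < 2 ^ l) :
    ∃ p : List Bool, p.length = l ∧ bitsVal p = a := by
  induction l generalizing a with
  | zero => exact ⟨[], rfl, by simp at ha; simp [bitsVal, ha]⟩
  | succ l ih =>
    obtain ⟨p, hp, hv⟩ := ih (a / 2) (by rw [pow_succ] at ha; omega)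
    refine ⟨p ++ [decide (a % 2 = 1)], by simp [hp], ?_⟩
    rw [bitsVal_concat, hv]
    rcases Nat.mod_two_eq_zero_or_one a with h | h <;> simp [h] <;> omega

/-! ### Dyadic partial sums -/

/-- The weight `2⁻ˡ` of an optional length `l`. -/
noncomputable def lenWeight (o : Option ℕ) : ℝ := o.elim 0 fun l => (1 / 2 : ℝ) ^ l

theorem lenWeight_nonneg (o : Option ℕ) : 0 ≤ lenWeight o := by
  cases o <;> simp [lenWeight]

/-- Numerator and binary logarithm of the denominator of `∑ i < m, lenWeight (g i)`. -/
def dyadicSum (g : ℕ → Option ℕ) (m : ℕ) : ℕ × ℕ :=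
  Nat.rec (0, 0) (fun i a => (g i).elim a fun l => (a.1 * 2 ^ l + 2 ^ a.2, a.2 + l)) m

theorem dyadicSum_spec (g : ℕ → Option ℕ) (m : ℕ) :
    ((dyadicSum g m).1 : ℝ) =
      (∑ i ∈ Finset.range m, lenWeight (g i)) * 2 ^ (dyadicSum g m).2 := by
  induction m with
  | zero => simp [dyadicSum]
  | succ m ih =>
    rw [Finset.sum_range_succ]
    have h : dyadicSum g (m + 1) = (g m).elim (dyadicSum g m) fun l =>
      ((dyadicSum g m).1 * 2 ^ l + 2 ^ (dyadicSum g m).2, (dyadicSum g m).2 + l) := rfl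
    rw [h]
    cases g m with
    | none => simpa [lenWeight] using ih
    | some l =>
      simp only [Option.elim_some, lenWeight, Nat.cast_add, Nat.cast_mul, Nat.cast_pow,
        Nat.cast_ofNat, ih, pow_add]
      have : (1 / 2 : ℝ) ^ l * 2 ^ l = 1 := by rw [← mul_pow]; norm_num
      linear_combination -(2 : ℝ) ^ (dyadicSum g m).2 * this

theorem Computable.dyadicSum {α : Type*} [Primcodable α] {g : α → ℕ → Option ℕ} {m : α → ℕ}
    (hg : Computable₂ g) (hm : Computable m) : Computable fun a => dyadicSum (g a) (m a) := by
  refine Computable.nat_rec (h := fun a (s : ℕ × ℕ × ℕ) =>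
    (g a s.1).elim s.2 fun l => (s.2.1 * 2 ^ l + 2 ^ s.2.2, s.2.2 + l))
    hm (Computable.const (0, 0)) ?_
  refine (Computable.option_casesOn (o := fun q : α × ℕ × ℕ × ℕ => g q.1 q.2.1)
    (f := fun q => q.2.2)
    (g := fun q l => (q.2.2.1 * 2 ^ l + 2 ^ q.2.2.2, q.2.2.2 + l)) ?_ ?_ ?_).of_eq ?_
  · exact hg.comp Computable.fst (Computable.fst.comp Computable.snd)
  · exact Computable.snd.comp Computable.snd
  · have h : Computable fun q : (α × ℕ × ℕ × ℕ) × ℕ => q.1.2.2 :=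
      Computable.snd.comp (Computable.snd.comp Computable.fst)
    have h1 := Computable.fst.comp h
    have h2 := Computable.snd.comp h
    exact ((h1.mul Computable.snd.two_pow).add h2.two_pow).pair (h2.add Computable.snd)
  · rintro ⟨a, i, s⟩
    dsimp only
    cases g a i <;> rfl

/-! ### Constructing machines -/

theorem exists_machine {g : List Bool × ℕ × ℕ →. ℕ} (hg : Partrec g) :
    ∃ N : Machine, ∀ p y n v, N.Outputs p y n v ↔ v ∈ g (p, y, n) := by
  obtain ⟨c, hc⟩ := Nat.Partrec.Code.exists_code.1 hg
  refine ⟨⟨fun t p y n => c.evaln t (Encodable.encode (p, y, n)), ?_, ?_⟩, ?_⟩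
  · refine Nat.Partrec.Code.primrec_evaln.to_comp.comp (((Computable.fst.comp Computable.fst).pair
      (Computable.const c)).pair (Computable.encode.comp ?_))
    exact (Computable.snd.comp Computable.fst).pair Computable.snd
  · intro t t' p y n v ht h
    exact Nat.Partrec.Code.evaln_mono ht h
  · intro p y n v
    refine Nat.Partrec.Code.evaln_complete.symm.trans ?_
    rw [hc]
    simp

namespace Machine

variable {Φ : Machine}

theorem Outputs.unique {p : List Bool} {y n v v' : ℕ} (h : Φ.Outputs p y n v)
    (h' : Φ.Outputs p y n v') : v = v' := by
  obtain ⟨t, ht⟩ := h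
  obtain ⟨t', ht'⟩ := h'
  have h1 := Φ.mono (le_max_left t t') ht
  have h2 := Φ.mono (le_max_right t t') ht'
  exact Option.some.inj (h1.symm.trans h2)

theorem Total.exists_shortestProg (h : Φ.Total) (x y n : ℕ) : ∃ p, Φ.ShortestProg p x y n := by
  obtain ⟨p, hp⟩ := h x y n
  obtain ⟨q, hq, hout⟩ := Nat.sInf_mem (s := {l | ∃ p : List Bool, p.length = l ∧
    Φ.Outputs p y n x}) ⟨_, p, rfl, hp⟩
  exact ⟨q, hout, hq⟩

theorem POptimal.exists_C_le (hΦ : Φ.POptimal) {g : List Bool × ℕ × ℕ →. ℕ} (hg : Partrec g)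
    (hpf : ∀ p q y n, (g (p, y, n)).Dom → (g (q, y, n)).Dom → p <+: q → p = q) :
    ∃ c, ∀ p y n v, v ∈ g (p, y, n) → Φ.C v y n ≤ p.length + c := by
  obtain ⟨N, hN⟩ := exists_machine hg
  obtain ⟨c, hc⟩ := hΦ.2.2 N (by
    rintro p q y n ⟨v, hv⟩ ⟨w, hw⟩
    exact hpf p q y n (Part.dom_iff_mem.2 ⟨v, (hN ..).1 hv⟩)
      (Part.dom_iff_mem.2 ⟨w, (hN ..).1 hw⟩))
  exact ⟨c, fun p y n v hv => hc p y n v ((hN ..).2 hv)⟩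

theorem mem_rfindOpt_step {p : List Bool} {y n v : ℕ} :
    v ∈ Nat.rfindOpt (fun t => Φ.step t p y n) ↔ Φ.Outputs p y n v :=
  Nat.rfindOpt_mono fun h h' => Φ.mono h h'

theorem computable_step_comp (Φ : Machine) {α : Type*} [Primcodable α] {t : α → ℕ}
    {p : α → List Bool} {y n : α → ℕ} (ht : Computable t) (hp : Computable p) (hy : Computable y)
    (hn : Computable n) : Computable fun a => Φ.step (t a) (p a) (y a) (n a) :=
  Φ.computable_step.comp ((ht.pair hp).pair (hy.pair hn))

/-- A condition computed from another one is at most as useful as the latter. -/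
theorem POptimal.exists_C_le_of_partrec (hΦ : Φ.POptimal) {g : ℕ × ℕ →. ℕ} (hg : Partrec g) :
    ∃ c, ∀ y n z x, z ∈ g (y, n) → Φ.C x y n ≤ Φ.C x z n + c := by
  have hpart : Partrec fun q : List Bool × ℕ × ℕ =>
      (g q.2).bind fun z => Nat.rfindOpt fun t => Φ.step t q.1 z q.2.2 := by
    refine (hg.comp Computable.snd).bind (Partrec.rfindOpt ?_)
    exact Φ.computable_step_comp Computable.snd
      (Computable.fst.comp (Computable.fst.comp Computable.fst))
      (Computable.snd.comp Computable.fst)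
      (Computable.snd.comp (Computable.snd.comp (Computable.fst.comp Computable.fst)))
  obtain ⟨c, hc⟩ := hΦ.exists_C_le hpart (by
    intro p q y n hp hq hpq
    obtain ⟨v, hv⟩ := Part.dom_iff_mem.1 hp
    obtain ⟨w, hw⟩ := Part.dom_iff_mem.1 hq
    obtain ⟨z, hz, hv⟩ := Part.mem_bind_iff.1 hv
    obtain ⟨z', hz', hw⟩ := Part.mem_bind_iff.1 hw
    obtain rfl := Part.mem_unique hz hz'
    exact hΦ.1 ⟨v, mem_rfindOpt_step.1 hv⟩ ⟨w, mem_rfindOpt_step.1 hw⟩ hpq)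
  refine ⟨c, fun y n z x hz => ?_⟩
  obtain ⟨p, hp, hl⟩ := hΦ.2.1.exists_shortestProg x z n
  rw [← hl]
  exact hc p y n x (Part.mem_bind_iff.2 ⟨z, hz, mem_rfindOpt_step.2 hp⟩)

end Machine

/-! ### The coding theorem -/

/-- The interval of `p` has length `2⁻ˡ⁻¹` and lies in `[s, s + 2⁻ˡ]`, where `s` is the dyadic number
`s.1 / 2 ^ s.2`. -/
def slotTest (p : List Bool) (l : ℕ) (s : ℕ × ℕ) : Bool :=
  (decide (p.length ≤ l + 1) && decide (l + 1 ≤ p.length)) &&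
    (decide (s.1 * 2 ^ p.length ≤ bitsVal p * 2 ^ s.2) &&
      decide ((bitsVal p + 1) * 2 ^ s.2 ≤ s.1 * 2 ^ p.length + 2 * 2 ^ s.2))

theorem slotTest_eq_true {p : List Bool} {l : ℕ} {s : ℕ × ℕ} {r : ℝ} (hr : (s.1 : ℝ) = r * 2 ^ s.2) :
    slotTest p l s = true ↔ p.length = l + 1 ∧ r ≤ bitsVal p / 2 ^ p.length ∧
      (bitsVal p + 1 : ℝ) / 2 ^ p.length ≤ r + (1 / 2) ^ l := by
  have h2 : (0 : ℝ) < 2 ^ s.2 := by positivity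
  have h1 : s.1 * 2 ^ p.length ≤ bitsVal p * 2 ^ s.2 ↔ r ≤ bitsVal p / 2 ^ p.length := by
    rw [le_div_iff₀ (by positivity), ← mul_le_mul_iff_left₀ h2, mul_right_comm, ← hr]
    exact_mod_cast Iff.rfl
  have h3 (hl : p.length = l + 1) : (bitsVal p + 1) * 2 ^ s.2 ≤ s.1 * 2 ^ p.length + 2 * 2 ^ s.2 ↔
      (bitsVal p + 1 : ℝ) / 2 ^ p.length ≤ r + (1 / 2) ^ l := by
    have h4 : (1 / 2 : ℝ) ^ l * 2 ^ p.length = 2 := by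
      rw [hl, pow_succ, ← mul_assoc, ← mul_pow]; norm_num
    rw [div_le_iff₀ (by positivity), add_mul r, h4, ← mul_le_mul_iff_left₀ h2,
      add_mul (r * _), mul_right_comm, ← hr]
    exact_mod_cast Iff.rfl
  simp only [slotTest, Bool.and_eq_true, decide_eq_true_eq, h1]
  constructor
  · rintro ⟨⟨ha, hb⟩, hc, hd⟩
    exact ⟨le_antisymm ha hb, hc, (h3 (le_antisymm ha hb)).1 hd⟩
  · rintro ⟨ha, hb, hc⟩
    exact ⟨⟨ha.le, ha.ge⟩, hb, (h3 ha).2 hc⟩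

theorem exists_slotTest {l : ℕ} {s : ℕ × ℕ} {r : ℝ} (hr : (s.1 : ℝ) = r * 2 ^ s.2) (h0 : 0 ≤ r)
    (h1 : r + (1 / 2) ^ l ≤ 1) : ∃ p, slotTest p l s = true := by
  have hpow : (1 / 2 : ℝ) ^ l * 2 ^ (l + 1) = 2 := by
    rw [pow_succ, ← mul_assoc, ← mul_pow]; norm_num
  have hpos : (0 : ℝ) < 2 ^ (l + 1) := by positivity
  have hc := Nat.ceil_lt_add_one (mul_nonneg h0 hpos.le)
  have hm := mul_le_mul_of_nonneg_right h1 hpos.le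
  rw [add_mul, hpow, one_mul] at hm
  obtain ⟨p, hp, hv⟩ := exists_bitsVal_eq (l + 1) ⌈r * 2 ^ (l + 1)⌉₊ (by
    have : ((⌈r * 2 ^ (l + 1)⌉₊ : ℕ) : ℝ) < (2 : ℝ) ^ (l + 1) := by linarith
    exact_mod_cast this)
  refine ⟨p, (slotTest_eq_true hr).2 ⟨hp, ?_, ?_⟩⟩
  · rw [hv, hp, le_div_iff₀ hpos]
    exact Nat.le_ceil _
  · rw [hv, hp, div_le_iff₀ hpos, add_mul, hpow]
    linarith

theorem Computable.slotTest {α : Type*} [Primcodable α] {p : α → List Bool} {l : α → ℕ}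
    {s : α → ℕ × ℕ} (hp : Computable p) (hl : Computable l) (hs : Computable s) :
    Computable fun a => slotTest (p a) (l a) (s a) := by
  have hlen := Computable.list_length.comp hp
  have hval := computable_bitsVal.comp hp
  have h1 := Computable.fst.comp hs
  have h2 := (Computable.snd.comp hs).two_pow
  have hl' := Computable.succ.comp hl
  have hm := h1.mul hlen.two_pow
  exact ((hlen.le hl').band (hl'.le hlen)).band ((hm.le (hval.mul h2)).band
    (((Computable.succ.comp hval).mul h2).le (hm.add ((Computable.const 2).mul h2))))

theorem bitsVal_div_le_append {p q : List Bool} (h : p <+: q) :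
    (bitsVal p : ℝ) / 2 ^ p.length ≤ bitsVal q / 2 ^ q.length ∧
      (bitsVal q + 1 : ℝ) / 2 ^ q.length ≤ (bitsVal p + 1) / 2 ^ p.length := by
  obtain ⟨r, rfl⟩ := h
  obtain ⟨h1, h2⟩ := bitsVal_append_bounds p r
  have h1' : (bitsVal p : ℝ) * 2 ^ r.length ≤ bitsVal (p ++ r) := by exact_mod_cast h1
  have h2' : (bitsVal (p ++ r) : ℝ) + 1 ≤ (bitsVal p + 1) * 2 ^ r.length := by exact_mod_cast h2
  rw [List.length_append, pow_add]
  constructor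
  · rw [div_le_div_iff₀ (by positivity) (by positivity)]
    nlinarith [mul_le_mul_of_nonneg_right h1' (by positivity : (0 : ℝ) ≤ 2 ^ p.length)]
  · rw [div_le_div_iff₀ (by positivity) (by positivity)]
    nlinarith [mul_le_mul_of_nonneg_right h2' (by positivity : (0 : ℝ) ≤ 2 ^ p.length)]

/-- Strings assigned by `slotTest` to the requests `g` are prefix-incomparable. -/
theorem eq_of_slotTest {g : ℕ → Option ℕ} {p q : List Bool} {m m' l l' : ℕ} (hg : g m = some l)
    (hg' : g m' = some l') (hp : slotTest p l (dyadicSum g m) = true)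
    (hq : slotTest q l' (dyadicSum g m') = true) (hpq : p <+: q) : m = m' := by
  obtain ⟨-, hp1, hp2⟩ := (slotTest_eq_true (dyadicSum_spec g m)).1 hp
  obtain ⟨-, hq1, hq2⟩ := (slotTest_eq_true (dyadicSum_spec g m')).1 hq
  obtain ⟨h1, h2⟩ := bitsVal_div_le_append hpq
  have hmono {i j k : ℕ} (hij : i < j) (hi : g i = some k) :
      ∑ a ∈ Finset.range i, lenWeight (g a) + (1 / 2 : ℝ) ^ k ≤
        ∑ a ∈ Finset.range j, lenWeight (g a) := by
    have h := Finset.sum_range_succ (fun a => lenWeight (g a)) i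
    have h' : lenWeight (g i) = (1 / 2 : ℝ) ^ k := by simp [hi, lenWeight]
    rw [← h', ← h]
    exact Finset.sum_le_sum_of_subset_of_nonneg (Finset.range_mono hij)
      fun _ _ _ => lenWeight_nonneg _
  have hlt : (bitsVal q : ℝ) / 2 ^ q.length < (bitsVal q + 1) / 2 ^ q.length := by
    gcongr
    linarith
  rcases lt_trichotomy m m' with h | h | h
  · linarith [hmono h hg]
  · exact h
  · linarith [hmono h hg']

/-- The `ℝ≥0∞`-valued version of `lenWeight`. -/
noncomputable def lenWeight' (o : Option ℕ) : ℝ≥0∞ := ENNReal.ofReal (lenWeight o)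

theorem ofReal_sum_range_lenWeight {ι : Type*} [Encodable ι] (G : ι → Option ℕ) (M : ℕ) :
    ENNReal.ofReal (∑ m ∈ Finset.range M, lenWeight ((Encodable.decode₂ ι m).bind G)) =
      ∑' a : ι, if Encodable.encode a < M then lenWeight' (G a) else 0 := by
  rw [ENNReal.ofReal_sum_of_nonneg fun _ _ => lenWeight_nonneg _]
  have h : Function.support (fun m => if m < M then
      lenWeight' ((Encodable.decode₂ ι m).bind G) else 0) ⊆ Set.range (Encodable.encode (α := ι)) := by
    intro m hm
    cases hd : Encodable.decode₂ ι m with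
    | none => simp [hd, lenWeight', lenWeight] at hm
    | some a => exact ⟨a, Encodable.mem_decode₂.1 hd⟩
  have h' := Encodable.encode_injective.tsum_eq h
  simp only [Encodable.decode₂_encode, Option.bind_some] at h'
  rw [h', tsum_eq_sum (s := Finset.range M) (by
    intro m hm
    simp at hm
    simp [hm])]
  refine Finset.sum_congr rfl fun m hm => ?_
  rw [if_pos (Finset.mem_range.1 hm), lenWeight']

/-- The value `f t` if `t` is the first time at which `f` has one. -/
def firstHit {α : Type*} (f : ℕ → Option α) (t : ℕ) : Option α :=
  bif decide (t ≤ 0) || !(f (t - 1)).isSome then f t else none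

theorem firstHit_eq_some {α : Type*} {f : ℕ → Option α} {t : ℕ} {a : α}
    (h : firstHit f t = some a) : f t = some a ∧ ∀ s < t, (∀ b, f s = some b → f (t - 1) = some b) →
      f s = none := by
  unfold firstHit at h
  rw [Bool.cond_eq_ite] at h
  split_ifs at h with hc
  refine ⟨h, fun s hs hmono => ?_⟩
  cases hf : f s with
  | none => rfl
  | some b => simp [hmono b hf] at hc; omega

theorem exists_firstHit {α : Type*} {f : ℕ → Option α}
    (hf : ∀ {t t' : ℕ} {a : α}, t ≤ t' → f t = some a → f t' = some a) {t : ℕ} {a : α}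
    (h : f t = some a) : ∃ s, firstHit f s = some a := by
  induction t with
  | zero => exact ⟨0, by simpa [firstHit] using h⟩
  | succ t ih =>
    cases ht : f t with
    | none => exact ⟨t + 1, by simp [firstHit, ht, h]⟩
    | some b =>
      have : b = a := Option.some.inj ((hf (Nat.le_succ t) ht).symm.trans h)
      exact ih (by rw [ht, this])

theorem tsum_firstHit_le {f : ℕ → Option ℕ}
    (hf : ∀ {t t' : ℕ} {a : ℕ}, t ≤ t' → f t = some a → f t' = some a) {b : ℝ≥0∞}
    (hb : ∀ t, lenWeight' (f t) ≤ b) : ∑' t, lenWeight' (firstHit f t) ≤ b := by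
  by_cases h : ∃ t a, firstHit f t = some a
  · obtain ⟨t, a, hta⟩ := h
    rw [tsum_eq_single t]
    · rw [hta, ← (firstHit_eq_some hta).1]
      exact hb t
    · intro t' ht'
      cases h' : firstHit f t' with
      | none => simp [lenWeight', lenWeight]
      | some a' =>
        rcases lt_or_gt_of_ne ht' with hlt | hlt
        · have := (firstHit_eq_some hta).2 t' hlt fun c => hf (by omega)
          rw [(firstHit_eq_some h').1] at this
          cases this
        · have := (firstHit_eq_some h').2 t hlt fun c => hf (by omega)
          rw [(firstHit_eq_some hta).1] at this
          cases this
  · push Not at h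
    have h0 : ∀ t, firstHit f t = none := fun t => Option.eq_none_iff_forall_ne_some.2 (h t)
    simp [h0, lenWeight', lenWeight]

theorem firstHit_map {α β : Type*} (f : ℕ → Option α) (φ : α → β) (t : ℕ) :
    (firstHit f t).map φ = firstHit (fun t => (f t).map φ) t := by
  simp only [firstHit, Option.isSome_map]
  cases decide (t ≤ 0) || !(f (t - 1)).isSome <;> rfl

/-- The enumeration of all pairs of an index and its first time of success. -/
def requests {ι : Type*} [Encodable ι] (f : ι → ℕ → Option (ℕ × ℕ)) (m : ℕ) : Option (ℕ × ℕ) :=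
  (Encodable.decode₂ (ι × ℕ) m).bind fun a => firstHit (f a.1) a.2

theorem Computable.requests {ι α : Type*} [Primcodable ι] [Primcodable α]
    {f : α → ι → ℕ → Option (ℕ × ℕ)} {m : α → ℕ}
    (hf : Computable fun q : α × ι × ℕ => f q.1 q.2.1 q.2.2) (hm : Computable m) :
    Computable fun a => requests (f a) (m a) := by
  refine Computable.option_bind (g := fun a (q : ι × ℕ) => firstHit (f a q.1) q.2)
    (Primrec.decode₂.to_comp.comp hm) ?_
  have ht : Computable fun q : α × ι × ℕ => q.2.2 := Computable.snd.comp Computable.snd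
  have hpred : Computable fun q : α × ι × ℕ => f q.1 q.2.1 (q.2.2 - 1) :=
    hf.comp (Computable.fst.pair ((Computable.fst.comp Computable.snd).pair
      (ht.sub (Computable.const 1))))
  exact Computable.cond (Primrec.or.to_comp.comp (ht.le (Computable.const 0))
    (Primrec.option_isSome.to_comp.comp hpred).bnot) hf (Computable.const none)

theorem sum_requests_le_one {ι : Type*} [Encodable ι] {f : ι → ℕ → Option (ℕ × ℕ)}
    (hf : ∀ i {t t' a}, t ≤ t' → f i t = some a → f i t' = some a) {b : ι → ℝ≥0∞}
    (hb : ∀ i t, lenWeight' ((f i t).map Prod.fst) ≤ b i) (hb1 : ∑' i, b i ≤ 1) (M : ℕ) :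
    ∑ m ∈ Finset.range M, lenWeight ((requests f m).map Prod.fst) ≤ 1 := by
  rw [← ENNReal.ofReal_le_one]
  have h (m : ℕ) : (requests f m).map Prod.fst =
      (Encodable.decode₂ (ι × ℕ) m).bind fun a => firstHit (fun t => (f a.1 t).map Prod.fst) a.2 := by
    simp only [requests, Option.map_bind, Function.comp_def, firstHit_map]
  simp only [h, ofReal_sum_range_lenWeight]
  calc _ ≤ ∑' a : ι × ℕ, lenWeight' (firstHit (fun t => (f a.1 t).map Prod.fst) a.2) := by
        refine ENNReal.tsum_le_tsum fun a => ?_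
        split_ifs <;> simp
    _ = ∑' i, ∑' t, lenWeight' (firstHit (fun t => (f i t).map Prod.fst) t) :=
        ENNReal.tsum_prod (f := fun i t => lenWeight' (firstHit (fun t => (f i t).map Prod.fst) t))
    _ ≤ ∑' i, b i := by
        refine ENNReal.tsum_le_tsum fun i => tsum_firstHit_le ?_ (hb i)
        intro t t' a ht h
        obtain ⟨q, hq, rfl⟩ := Option.map_eq_some_iff.1 h
        simp [hf i ht hq]
    _ ≤ 1 := hb1

/-- The value requested at stage `m` of the sequence `R` of requests, if `p` is assigned to it. -/
def slotValue (R : ℕ → Option (ℕ × ℕ)) (p : List Bool) (m : ℕ) : Option ℕ :=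
  (R m).bind fun a => guardSome (slotTest p a.1 (dyadicSum (fun k => (R k).map Prod.fst) m)) a.2

theorem computable_slotValue {α : Type*} [Primcodable α] {R : α → ℕ → Option (ℕ × ℕ)}
    (hR : Computable fun q : α × ℕ => R q.1 q.2) :
    Computable₂ fun (q : List Bool × α) m => slotValue (R q.2) q.1 m := by
  have hs : Computable fun q : (List Bool × α) × ℕ => q.1.2 := Computable.snd.comp Computable.fst
  have hL : Computable fun q : ((List Bool × α) × ℕ) × ℕ => (R q.1.1.2 q.2).map Prod.fst :=
    Computable.option_map
      (Computable.comp (f := fun q : α × ℕ => R q.1 q.2)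
        (g := fun q : ((List Bool × α) × ℕ) × ℕ => (q.1.1.2, q.2)) hR
        ((hs.comp Computable.fst).pair Computable.snd))
      (g := fun _ (a : ℕ × ℕ) => a.1) (Computable.fst.comp Computable.snd)
  have hD : Computable fun q : (List Bool × α) × ℕ =>
      dyadicSum (fun k => (R q.1.2 k).map Prod.fst) q.2 :=
    Computable.dyadicSum (g := fun (q : (List Bool × α) × ℕ) k => (R q.1.2 k).map Prod.fst)
      hL Computable.snd
  have hb : Computable fun q : ((List Bool × α) × ℕ) × ℕ × ℕ =>
      slotTest q.1.1.1 q.2.1 (dyadicSum (fun k => (R q.1.1.2 k).map Prod.fst) q.1.2) :=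
    Computable.slotTest (Computable.fst.comp (Computable.fst.comp Computable.fst))
      (Computable.fst.comp Computable.snd) (hD.comp Computable.fst)
  have hg := hb.guardSome (f := fun q => q.2.2) (Computable.snd.comp Computable.snd)
  have hR' : Computable fun q : (List Bool × α) × ℕ => R q.1.2 q.2 :=
    Computable.comp (f := fun q : α × ℕ => R q.1 q.2)
      (g := fun q : (List Bool × α) × ℕ => (q.1.2, q.2)) hR (hs.pair Computable.snd)
  exact Computable.option_bind hR' hg.to₂

theorem slotValue_eq_some {R : ℕ → Option (ℕ × ℕ)} {p : List Bool} {m v : ℕ} :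
    slotValue R p m = some v ↔ ∃ l, R m = some (l, v) ∧
      slotTest p l (dyadicSum (fun k => (R k).map Prod.fst) m) = true := by
  simp only [slotValue, Option.bind_eq_some_iff, guardSome_eq_some, Prod.exists]
  constructor
  · rintro ⟨l, v', h, hs, rfl⟩
    exact ⟨l, h, hs⟩
  · rintro ⟨l, h, hs⟩
    exact ⟨l, v, h, hs, rfl⟩

theorem eq_of_slotValue {R : ℕ → Option (ℕ × ℕ)} {p q : List Bool} {m m' v v' : ℕ}
    (h : slotValue R p m = some v) (h' : slotValue R q m' = some v') (hpq : p <+: q) :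
    v = v' ∧ p = q := by
  obtain ⟨l, hr, ht⟩ := slotValue_eq_some.1 h
  obtain ⟨l', hr', ht'⟩ := slotValue_eq_some.1 h'
  obtain rfl := eq_of_slotTest (g := fun k => (R k).map Prod.fst) (by simp [hr]) (by simp [hr'])
    ht ht' hpq
  obtain ⟨rfl, rfl⟩ : l = l' ∧ v = v' := by simpa [hr] using hr'
  refine ⟨rfl, hpq.eq_of_length ?_⟩
  rw [((slotTest_eq_true (dyadicSum_spec _ _)).1 ht).1,
    ((slotTest_eq_true (dyadicSum_spec _ _)).1 ht').1]

/-- The coding theorem: objects requested effectively, with lengths satisfying Kraft's inequality,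
have complexity bounded by the requested lengths. -/
theorem Machine.POptimal.exists_C_le_of_requests {Φ : Machine} (hΦ : Φ.POptimal) {ι : Type*}
    [Primcodable ι] {f : ℕ × ℕ → ι → ℕ → Option (ℕ × ℕ)}
    (hcomp : Computable fun q : (ℕ × ℕ) × ι × ℕ => f q.1 q.2.1 q.2.2)
    (hf : ∀ s i {t t' a}, t ≤ t' → f s i t = some a → f s i t' = some a) :
    ∃ c, ∀ y n, ∀ b : ι → ℝ≥0∞, (∀ i t, lenWeight' ((f (y, n) i t).map Prod.fst) ≤ b i) →
      ∑' i, b i ≤ 1 → ∀ i t l v, f (y, n) i t = some (l, v) → Φ.C v y n ≤ l + c := by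
  have hR : Computable fun q : (ℕ × ℕ) × ℕ => requests (f q.1) q.2 :=
    Computable.requests (α := (ℕ × ℕ) × ℕ) (f := fun q => f q.1) (m := Prod.snd)
      (Computable.comp (f := fun q : (ℕ × ℕ) × ι × ℕ => f q.1 q.2.1 q.2.2)
        (g := fun q : ((ℕ × ℕ) × ℕ) × ι × ℕ => (q.1.1, q.2)) hcomp
        ((Computable.fst.comp Computable.fst).pair Computable.snd)) Computable.snd
  obtain ⟨c, hc⟩ := hΦ.exists_C_le (Partrec.rfindOpt
    (computable_slotValue (R := fun s m => requests (f s) m) hR)) (by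
    intro p q y n hp hq hpq
    obtain ⟨m, v, hv⟩ := Nat.rfindOpt_dom.1 hp
    obtain ⟨m', v', hv'⟩ := Nat.rfindOpt_dom.1 hq
    exact (eq_of_slotValue hv hv' hpq).2)
  refine ⟨c + 1, fun y n b hb hb1 i t l v h => ?_⟩
  obtain ⟨t₀, ht₀⟩ := exists_firstHit (hf (y, n) i) h
  have hRm : requests (f (y, n)) (Encodable.encode (i, t₀)) = some (l, v) := by
    simp only [requests, Encodable.decode₂_encode, Option.bind_some, ht₀]
  set m := Encodable.encode (i, t₀) with hm
  have hle := sum_requests_le_one (hf (y, n)) hb hb1 (m + 1)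
  rw [Finset.sum_range_succ] at hle
  obtain ⟨p, hp⟩ := exists_slotTest (l := l) (dyadicSum_spec (fun k => (requests (f (y, n)) k).map Prod.fst) m)
    (Finset.sum_nonneg fun _ _ => lenWeight_nonneg _) (by
      have : lenWeight ((requests (f (y, n)) m).map Prod.fst) = (1 / 2 : ℝ) ^ l := by
        simp [hRm, lenWeight]
      rw [← this]
      exact hle)
  have hTm : slotValue (requests (f (y, n))) p m = some v :=
    slotValue_eq_some.2 ⟨l, hRm, hp⟩
  have hdom : (Nat.rfindOpt (slotValue (requests (f (y, n))) p)).Dom := Nat.rfindOpt_dom.2 ⟨m, v, hTm⟩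
  obtain ⟨v', hv'⟩ := Part.dom_iff_mem.1 hdom
  obtain ⟨m', hm'⟩ := Nat.rfindOpt_spec hv'
  obtain rfl := (eq_of_slotValue hTm hm' List.prefix_rfl).1
  have hlen := ((slotTest_eq_true (dyadicSum_spec (fun k => (requests (f (y, n)) k).map Prod.fst) m)).1 hp).1
  have := hc p y n v hv'
  omega

/-! ### Weights of sets of programs -/

theorem lenWeight'_some (l : ℕ) : lenWeight' (some l) = 2⁻¹ ^ l := by
  rw [lenWeight', lenWeight, Option.elim_some, ENNReal.ofReal_pow (by norm_num), one_div,
    ENNReal.ofReal_inv_of_pos two_pos, ENNReal.ofReal_ofNat]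

theorem lenWeight'_none : lenWeight' none = 0 := by simp [lenWeight', lenWeight]

/-- `∑ p ∈ S, 2^(-|p|)`. -/
noncomputable def progWeight (S : Set (List Bool)) : ℝ≥0∞ :=
  ∑' p, S.indicator (fun p => 2⁻¹ ^ p.length) p

theorem progWeight_mono {S T : Set (List Bool)} (h : S ⊆ T) : progWeight S ≤ progWeight T :=
  ENNReal.tsum_le_tsum fun _ => Set.indicator_le_indicator_of_subset h (fun _ => zero_le) _

theorem progWeight_add_diff {S T : Set (List Bool)} (h : T ⊆ S) :
    progWeight T + progWeight (S \ T) = progWeight S := by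
  rw [progWeight, progWeight, ← ENNReal.tsum_add, progWeight]
  refine tsum_congr fun p => ?_
  by_cases hT : p ∈ T
  · simp [hT, h hT]
  · by_cases hS : p ∈ S <;> simp [hT, hS]

theorem inv_two_pow_le_progWeight {S : Set (List Bool)} {p : List Bool} (hp : p ∈ S) :
    2⁻¹ ^ p.length ≤ progWeight S := by
  have := ENNReal.le_tsum (f := S.indicator fun p : List Bool => (2⁻¹ : ℝ≥0∞) ^ p.length) p
  rwa [Set.indicator_of_mem hp] at this

theorem exists_finset_lt_progWeight {S : Set (List Bool)} {a : ℝ≥0∞} (h : a < progWeight S) :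
    ∃ F : Finset (List Bool), ↑F ⊆ S ∧ a < progWeight F := by
  rw [progWeight, ENNReal.tsum_eq_iSup_sum, lt_iSup_iff] at h
  obtain ⟨F, hF⟩ := h
  refine ⟨F.filter (· ∈ S), fun p hp => (Finset.mem_filter.1 hp).2, hF.trans_le ?_⟩
  rw [progWeight]
  refine le_trans (Finset.sum_le_sum fun p hp => ?_) (ENNReal.sum_le_tsum F)
  by_cases hS : p ∈ S <;> simp_all

theorem uniquelyDecodable_of_prefixFree {S : Set (List Bool)} (h0 : [] ∉ S)
    (hS : ∀ p ∈ S, ∀ q ∈ S, p <+: q → p = q) : InformationTheory.UniquelyDecodable S := by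
  intro L₁
  induction L₁ with
  | nil =>
    rintro (_ | ⟨q, L₂⟩) - h2 h
    · rfl
    · simp at h
      exact absurd (h.1 ▸ h2 q (by simp)) h0
  | cons p L₁ ih =>
    rintro (_ | ⟨q, L₂⟩) h1 h2 h
    · simp at h
      exact absurd (h.1 ▸ h1 p (by simp)) h0
    · simp only [List.flatten_cons] at h
      have hp := h1 p (by simp)
      have hq := h2 q (by simp)
      obtain rfl : p = q := by
        have hp' := List.prefix_append p L₁.flatten
        have hq' : q <+: p ++ L₁.flatten := h ▸ List.prefix_append q L₂.flatten
        rcases le_total p.length q.length with hl | hl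
        · exact hS p hp q hq (List.prefix_of_prefix_length_le hp' hq' hl)
        · exact (hS q hq p hp (List.prefix_of_prefix_length_le hq' hp' hl)).symm
      rw [ih L₂ (fun w hw => h1 w (by simp [hw])) (fun w hw => h2 w (by simp [hw]))
        (List.append_cancel_left h)]

/-- Kraft's inequality. -/
theorem progWeight_le_one {S : Set (List Bool)} (hS : ∀ p ∈ S, ∀ q ∈ S, p <+: q → p = q) :
    progWeight S ≤ 1 := by
  by_cases h0 : [] ∈ S
  · have : S ⊆ {[]} := fun p hp => (hS [] h0 p hp List.nil_prefix).symm
    refine (progWeight_mono this).trans ?_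
    rw [progWeight, tsum_eq_single []]
    · simp
    · intro p hp
      simp [hp]
  · by_contra! h
    obtain ⟨F, hF, hlt⟩ := exists_finset_lt_progWeight h
    have hk := InformationTheory.kraft_mcmillan_inequality (uniquelyDecodable_of_prefixFree
      (fun h => h0 (hF h)) fun p hp q hq => hS p (hF hp) q (hF hq))
    rw [progWeight, tsum_eq_sum (s := F) (by
      intro p hp
      simp [hp])] at hlt
    refine absurd hlt (not_lt.2 ?_)
    rw [← ENNReal.ofReal_le_one, ENNReal.ofReal_sum_of_nonneg (by intros; positivity)] at hk
    refine le_trans (Finset.sum_le_sum fun p hp => ?_) hk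
    rw [Set.indicator_of_mem (Finset.mem_coe.2 hp), ← lenWeight'_some, lenWeight', lenWeight]
    simp

namespace Machine

variable {Φ : Machine}

/-- The programs producing an element of `2ⁿ`. -/
def haltSet (Φ : Machine) (n : ℕ) : Set (List Bool) := {p | ∃ v < 2 ^ n, Φ.Outputs p 0 n v}

/-- The programs producing an element of `2ⁿ` within time `t`. -/
def haltSetAt (Φ : Machine) (n t : ℕ) : Set (List Bool) :=
  {p | ∃ v < 2 ^ n, Φ.step t p 0 n = some v}

/-- The programs with code less than `s` producing an element of `2ⁿ` within time `t`. -/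
def haltSetBelow (Φ : Machine) (n t s : ℕ) : Set (List Bool) :=
  {p | Encodable.encode p < s ∧ p ∈ Φ.haltSetAt n t}

theorem haltSetAt_subset (n t : ℕ) : Φ.haltSetAt n t ⊆ Φ.haltSet n :=
  fun _ ⟨v, hv, h⟩ => ⟨v, hv, t, h⟩

theorem haltSetBelow_subset (n t s : ℕ) : Φ.haltSetBelow n t s ⊆ Φ.haltSetAt n t :=
  fun _ h => h.2

theorem PrefixFree.progWeight_haltSet_le_one (h : Φ.PrefixFree) (n : ℕ) :
    progWeight (Φ.haltSet n) ≤ 1 :=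
  progWeight_le_one fun _ ⟨v, _, hv⟩ _ ⟨w, _, hw⟩ => h ⟨v, hv⟩ ⟨w, hw⟩

theorem toReal_indicator_inv_two_pow (S : Set (List Bool)) (p : List Bool) :
    (S.indicator (fun p => (2⁻¹ : ℝ≥0∞) ^ p.length) p).toReal =
      if p ∈ S then (2 : ℝ) ^ (-(p.length : ℤ)) else 0 := by
  split_ifs with h <;> simp [h]

theorem toReal_progWeight (S : Set (List Bool)) :
    (progWeight S).toReal = ∑' p, if p ∈ S then (2 : ℝ) ^ (-(p.length : ℤ)) else 0 := by
  rw [progWeight, ENNReal.tsum_toReal_eq]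
  · simp only [toReal_indicator_inv_two_pow]
  · intro p
    by_cases h : p ∈ S <;> simp [h]

theorem Omega_eq (n : ℕ) : Φ.Omega n = (progWeight (Φ.haltSet n)).toReal := by
  rw [toReal_progWeight]
  exact tsum_congr fun p => if_congr Iff.rfl rfl rfl

theorem OmegaT_eq (n t : ℕ) : Φ.OmegaT n t = (progWeight (Φ.haltSetAt n t)).toReal := by
  rw [toReal_progWeight]
  exact tsum_congr fun p => if_congr Iff.rfl rfl rfl

theorem exists_lt_progWeight_haltSetBelow {n : ℕ} {a : ℝ≥0∞} (h : a < progWeight (Φ.haltSet n)) :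
    ∃ s, a < progWeight (Φ.haltSetBelow n s s) := by
  obtain ⟨F, hF, ha⟩ := exists_finset_lt_progWeight h
  have hF' : ∀ p ∈ F, ∃ v τ, v < 2 ^ n ∧ Φ.step τ p 0 n = some v := fun p hp =>
    let ⟨v, hv, τ, hτ⟩ := hF hp
    ⟨v, τ, hv, hτ⟩
  choose! v τ hv using hF'
  refine ⟨F.sup fun p => max (Encodable.encode p + 1) (τ p), ha.trans_le (progWeight_mono ?_)⟩
  intro p hp
  have hle := Finset.le_sup (f := fun p => max (Encodable.encode p + 1) (τ p)) hp
  exact ⟨(le_max_left _ _).trans hle, v p, (hv p hp).1,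
    Φ.mono ((le_max_right _ _).trans hle) (hv p hp).2⟩

end Machine

namespace Machine

variable {Φ : Machine}

/-! ### The upper bound -/

theorem OmegaBits_le (hΦ : Φ.PrefixFree) (n k : ℕ) : Φ.OmegaBits n k ≤ 2 ^ k := by
  refine Nat.floor_le_of_le ?_
  rw [Omega_eq]
  have h := ENNReal.toReal_mono ENNReal.one_ne_top (hΦ.progWeight_haltSet_le_one n)
  rw [ENNReal.toReal_one] at h
  push_cast
  nlinarith [pow_pos (two_pos (α := ℝ)) k]

/-- Requests for `(j, k, w, p)`: the output of `p` on the condition `(w, k)`, described by `p`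
together with self-delimiting codes of `j`, of `k < 2ʲ` and of `w ≤ 2ᵏ`. -/
def pairRequests (Φ : Machine) (n : ℕ) (i : ℕ × ℕ × ℕ × List Bool) (t : ℕ) : Option (ℕ × ℕ) :=
  (Φ.step t i.2.2.2 (Nat.pair i.2.2.1 i.2.1) n).bind fun v =>
    guardSome (decide (i.2.1 + 1 ≤ 2 ^ i.1) && decide (i.2.2.1 ≤ 2 ^ i.2.1))
      (i.2.2.2.length + (i.2.1 + 2 * i.1 + 2), v)

theorem pairRequests_eq_some {n t l v : ℕ} {i : ℕ × ℕ × ℕ × List Bool} :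
    Φ.pairRequests n i t = some (l, v) ↔
      Φ.step t i.2.2.2 (Nat.pair i.2.2.1 i.2.1) n = some v ∧
        (i.2.1 < 2 ^ i.1 ∧ i.2.2.1 ≤ 2 ^ i.2.1) ∧
          i.2.2.2.length + (i.2.1 + 2 * i.1 + 2) = l := by
  simp only [pairRequests, Option.bind_eq_some_iff, guardSome_eq_some, Bool.and_eq_true,
    decide_eq_true_eq, Prod.mk.injEq, Nat.add_one_le_iff]
  constructor
  · rintro ⟨v', h, hs, hl, rfl⟩
    exact ⟨h, hs, hl⟩
  · rintro ⟨h, hs, hl⟩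
    exact ⟨v, h, hs, hl, rfl⟩

theorem computable_pairRequests (Φ : Machine) :
    Computable fun q : (ℕ × ℕ) × (ℕ × ℕ × ℕ × List Bool) × ℕ =>
      Φ.pairRequests q.1.2 q.2.1 q.2.2 := by
  have hi : Computable fun q : (ℕ × ℕ) × (ℕ × ℕ × ℕ × List Bool) × ℕ => q.2.1 :=
    Computable.fst.comp Computable.snd
  have hj := Computable.fst.comp hi
  have hk := Computable.fst.comp (Computable.snd.comp hi)
  have hw := Computable.fst.comp (Computable.snd.comp (Computable.snd.comp hi))
  have hp := Computable.snd.comp (Computable.snd.comp (Computable.snd.comp hi))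
  have hstep := Φ.computable_step_comp (Computable.snd.comp Computable.snd) hp
    (Primrec₂.natPair.to_comp.comp hw hk) (Computable.snd.comp Computable.fst)
  have hb := ((Computable.succ.comp hk).le hj.two_pow).band (hw.le hk.two_pow)
  have hl := (Computable.list_length.comp hp).add ((hk.add ((Computable.const 2).mul hj)).add
    (Computable.const 2))
  have hg := (hb.comp (Computable.fst (β := ℕ))).guardSome
    ((hl.comp Computable.fst).pair Computable.snd)
  exact Computable.option_bind hstep hg.to₂

/-- The total weight of the requests for `(j, k, w, p)`. -/
noncomputable def pairWeight (Φ : Machine) (n : ℕ) (i : ℕ × ℕ × ℕ × List Bool) : ℝ≥0∞ :=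
  if i.2.1 < 2 ^ i.1 ∧ i.2.2.1 ≤ 2 ^ i.2.1 then
    {p | Φ.HaltsOn p (Nat.pair i.2.2.1 i.2.1) n}.indicator (fun p => 2⁻¹ ^ p.length) i.2.2.2 *
      2⁻¹ ^ (i.2.1 + 2 * i.1 + 2)
  else 0

theorem lenWeight_pairRequests_le (n : ℕ) (i : ℕ × ℕ × ℕ × List Bool) (t : ℕ) :
    lenWeight' ((Φ.pairRequests n i t).map Prod.fst) ≤ Φ.pairWeight n i := by
  cases h : Φ.pairRequests n i t with
  | none => simp [lenWeight'_none]
  | some a =>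
    obtain ⟨hs, hi, hl⟩ := pairRequests_eq_some.1 h
    have hmem : i.2.2.2 ∈ {p | Φ.HaltsOn p (Nat.pair i.2.2.1 i.2.1) n} := ⟨a.2, t, hs⟩
    rw [pairWeight, if_pos hi, Set.indicator_of_mem hmem, Option.map_some, lenWeight'_some, ← hl,
      pow_add]

theorem sum_pairWeight_le_one (hΦ : Φ.PrefixFree) (n : ℕ) : ∑' i, Φ.pairWeight n i ≤ 1 := by
  have hinv (m : ℕ) : (2 : ℝ≥0∞) ^ m * 2⁻¹ ^ m = 1 := by
    rw [← mul_pow, ENNReal.mul_inv_cancel two_ne_zero ENNReal.ofNat_ne_top, one_pow]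
  calc ∑' i, Φ.pairWeight n i
      = ∑' j, ∑' k, ∑' w, ∑' p, Φ.pairWeight n (j, k, w, p) := by
        rw [ENNReal.tsum_prod']
        simp only [ENNReal.tsum_prod']
    _ ≤ ∑' j : ℕ, ∑' k : ℕ, ∑' w : ℕ,
          if k < 2 ^ j ∧ w ≤ 2 ^ k then (2⁻¹ : ℝ≥0∞) ^ (k + 2 * j + 2) else 0 := by
        refine ENNReal.tsum_le_tsum fun j => ENNReal.tsum_le_tsum fun k =>
          ENNReal.tsum_le_tsum fun w => ?_
        by_cases h : k < 2 ^ j ∧ w ≤ 2 ^ k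
        · simp only [pairWeight, if_pos h, ENNReal.tsum_mul_right]
          refine mul_le_of_le_one_left' (progWeight_le_one ?_)
          exact fun p hp q hq => hΦ hp hq
        · simp only [pairWeight, if_neg h, tsum_zero, le_refl]
    _ ≤ ∑' j : ℕ, ∑' k : ℕ, if k < 2 ^ j then (2⁻¹ : ℝ≥0∞) ^ (2 * j + 1) else 0 := by
        refine ENNReal.tsum_le_tsum fun j => ENNReal.tsum_le_tsum fun k => ?_
        split_ifs with hk
        · rw [tsum_eq_sum (s := Finset.range (2 ^ k + 1)) (by
            intro w hw
            rw [if_neg fun h => hw (Finset.mem_range.2 (Nat.lt_succ_of_le h.2))])]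
          refine (Finset.sum_le_card_nsmul _ _ ((2⁻¹ : ℝ≥0∞) ^ (k + 2 * j + 2))
            fun w _ => ?_).trans ?_
          · split_ifs <;> simp
          · have h1 : ((2 : ℝ≥0∞) ^ k + 1) ≤ 2 ^ (k + 1) := by
              rw [pow_succ, mul_two]
              gcongr
              exact one_le_pow₀ one_le_two
            rw [Finset.card_range, nsmul_eq_mul]
            push_cast
            calc ((2 : ℝ≥0∞) ^ k + 1) * 2⁻¹ ^ (k + 2 * j + 2)
                ≤ 2 ^ (k + 1) * 2⁻¹ ^ (k + 2 * j + 2) := by gcongr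
              _ = (2 ^ (k + 1) * 2⁻¹ ^ (k + 1)) * 2⁻¹ ^ (2 * j + 1) := by ring
              _ = 2⁻¹ ^ (2 * j + 1) := by rw [hinv, one_mul]
        · simp [hk]
    _ = ∑' j : ℕ, (2⁻¹ : ℝ≥0∞) ^ (j + 1) := by
        refine tsum_congr fun j => ?_
        rw [tsum_eq_sum (s := Finset.range (2 ^ j)) (by
          intro k hk
          rw [if_neg fun h => hk (Finset.mem_range.2 h)]),
          Finset.sum_congr rfl fun k hk => if_pos (Finset.mem_range.1 hk), Finset.sum_const,
          Finset.card_range, nsmul_eq_mul]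
        push_cast
        calc (2 : ℝ≥0∞) ^ j * 2⁻¹ ^ (2 * j + 1) = (2 ^ j * 2⁻¹ ^ j) * 2⁻¹ ^ (j + 1) := by ring
          _ = 2⁻¹ ^ (j + 1) := by rw [hinv, one_mul]
    _ = 1 := by
        simp only [pow_succ, ENNReal.tsum_mul_right, ENNReal.tsum_geometric]
        rw [ENNReal.one_sub_inv_two, inv_inv,
          ENNReal.mul_inv_cancel two_ne_zero ENNReal.ofNat_ne_top]

theorem POptimal.C_le_add_C_pair (hΦ : Φ.POptimal) : ∃ c, ∀ n k w x, w ≤ 2 ^ k →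
    Φ.C x 0 n ≤ k + Φ.C x (Nat.pair w k) n + 2 * Nat.log 2 k + c := by
  obtain ⟨c, hc⟩ := hΦ.exists_C_le_of_requests (f := fun s => Φ.pairRequests s.2)
    Φ.computable_pairRequests (by
      rintro s i t t' ⟨l, v⟩ ht h
      obtain ⟨hs, hi⟩ := pairRequests_eq_some.1 h
      exact pairRequests_eq_some.2 ⟨Φ.mono ht hs, hi⟩)
  refine ⟨c + 4, fun n k w x hw => ?_⟩
  obtain ⟨p, ⟨t, ht⟩, hl⟩ := hΦ.2.1.exists_shortestProg x (Nat.pair w k) n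
  have h := hc 0 n (Φ.pairWeight n) (lenWeight_pairRequests_le n) (sum_pairWeight_le_one hΦ.1 n)
    (Nat.log 2 k + 1, k, w, p) t _ x
    (pairRequests_eq_some.2 ⟨ht, ⟨Nat.lt_pow_succ_log_self one_lt_two k, hw⟩, rfl⟩)
  dsimp only at h
  omega

end Machine

namespace Machine

variable {Φ : Machine}

/-! ### The lower bound -/

/-- The length of `p` if `p ∈ Φ.haltSetAt n t`. -/
def haltLength (Φ : Machine) (n t : ℕ) (p : List Bool) : Option ℕ :=
  (Φ.step t p 0 n).bind fun v => guardSome (decide (v + 1 ≤ 2 ^ n)) p.length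

theorem haltLength_eq_some {n t l : ℕ} {p : List Bool} :
    Φ.haltLength n t p = some l ↔ p ∈ Φ.haltSetAt n t ∧ p.length = l := by
  simp only [haltLength, Option.bind_eq_some_iff, guardSome_eq_some, decide_eq_true_eq,
    Nat.add_one_le_iff, haltSetAt, Set.mem_ofPred_eq]
  constructor
  · rintro ⟨v, h, hv, hl⟩
    exact ⟨⟨v, hv, h⟩, hl⟩
  · rintro ⟨⟨v, hv, h⟩, hl⟩
    exact ⟨v, h, hv, hl⟩

theorem isSome_haltLength {n t : ℕ} {p : List Bool} :
    (Φ.haltLength n t p).isSome = true ↔ p ∈ Φ.haltSetAt n t := by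
  simp [Option.isSome_iff_exists, haltLength_eq_some]

theorem computable_haltLength (Φ : Machine) {α : Type*} [Primcodable α] {n t : α → ℕ}
    {p : α → List Bool} (hn : Computable n) (ht : Computable t) (hp : Computable p) :
    Computable fun a => Φ.haltLength (n a) (t a) (p a) := by
  have hstep := Φ.computable_step_comp ht hp (Computable.const 0) hn
  have hb := (Computable.succ.comp (Computable.snd (α := α) (β := ℕ))).le
    (hn.comp Computable.fst).two_pow
  have hg := hb.guardSome (Computable.list_length.comp (hp.comp Computable.fst))
  exact Computable.option_bind hstep hg.to₂

/-- The weight of `Φ.haltSetBelow n t s` as a dyadic number. -/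
def massBelow (Φ : Machine) (n t s : ℕ) : ℕ × ℕ :=
  dyadicSum (fun m => (Encodable.decode₂ (List Bool) m).bind (Φ.haltLength n t)) s

theorem massBelow_spec (n t s : ℕ) : ((Φ.massBelow n t s).1 : ℝ) =
    (progWeight (Φ.haltSetBelow n t s)).toReal * 2 ^ (Φ.massBelow n t s).2 := by
  rw [massBelow, dyadicSum_spec]
  congr 1
  rw [← ENNReal.toReal_ofReal (Finset.sum_nonneg fun _ _ => lenWeight_nonneg _),
    ofReal_sum_range_lenWeight, progWeight]
  congr 1
  refine tsum_congr fun p => ?_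
  by_cases hs : Encodable.encode p < s
  · rw [if_pos hs]
    by_cases hp : p ∈ Φ.haltSetAt n t
    · rw [Set.indicator_of_mem (show p ∈ Φ.haltSetBelow n t s from ⟨hs, hp⟩),
        haltLength_eq_some.2 ⟨hp, rfl⟩, lenWeight'_some]
    · rw [Set.indicator_of_notMem (fun h => hp h.2), Option.eq_none_iff_forall_ne_some.2
        fun l hl => hp (haltLength_eq_some.1 hl).1, lenWeight'_none]
  · rw [if_neg hs, Set.indicator_of_notMem (fun h => hs h.1)]

theorem computable_massBelow (Φ : Machine) {α : Type*} [Primcodable α] {n t s : α → ℕ}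
    (hn : Computable n) (ht : Computable t) (hs : Computable s) :
    Computable fun a => Φ.massBelow (n a) (t a) (s a) := by
  have hl : Computable fun q : (α × ℕ) × List Bool => Φ.haltLength (n q.1.1) (t q.1.1) q.2 :=
    Φ.computable_haltLength (hn.comp (Computable.fst.comp Computable.fst))
      (ht.comp (Computable.fst.comp Computable.fst)) Computable.snd
  have hd : Computable fun q : α × ℕ => Encodable.decode₂ (List Bool) q.2 :=
    Primrec.decode₂.to_comp.comp Computable.snd
  have hg := Computable.option_bind hd hl.to₂
  exact Computable.dyadicSum hg.to₂ hs

/-- Decides whether `w ≤ 2ᵏ * m + a`, where `m` is the weight of `Φ.haltSetBelow n t s`. -/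
def massTest (Φ : Machine) (w k a n t s : ℕ) : Bool :=
  decide (w * 2 ^ (Φ.massBelow n t s).2 ≤
    (Φ.massBelow n t s).1 * 2 ^ k + a * 2 ^ (Φ.massBelow n t s).2)

theorem massTest_eq_true {w k a n t s : ℕ} : Φ.massTest w k a n t s = true ↔
    (w : ℝ) ≤ (progWeight (Φ.haltSetBelow n t s)).toReal * 2 ^ k + a := by
  have h2 : (0 : ℝ) < 2 ^ (Φ.massBelow n t s).2 := by positivity
  rw [massTest, decide_eq_true_eq, ← mul_le_mul_iff_left₀ h2, add_mul, mul_right_comm,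
    ← massBelow_spec]
  exact_mod_cast Iff.rfl

theorem computable_massTest (Φ : Machine) {α : Type*} [Primcodable α] {w k n t s : α → ℕ} (a : ℕ)
    (hw : Computable w) (hk : Computable k) (hn : Computable n) (ht : Computable t)
    (hs : Computable s) : Computable fun q => Φ.massTest (w q) (k q) a (n q) (t q) (s q) := by
  have hm := Φ.computable_massBelow hn ht hs
  have he := (Computable.snd.comp hm).two_pow
  exact (hw.mul he).le (((Computable.fst.comp hm).mul hk.two_pow).add
    ((Computable.const a).mul he))

/-- Given `(w, k)` with `w` the first `k` bits of `Ωⁿ`, finds a bound `s` on programs and times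
which accounts for `Ωⁿ` up to `2 * 2⁻ᵏ`, and a time `t` at which the programs up to `s` account for
`Ωⁿ` up to `5 * 2⁻ᵏ`. -/
def searchTime (Φ : Machine) (q : ℕ × ℕ) : Part ℕ :=
  (Nat.rfind fun s => Part.some (Φ.massTest q.1.unpair.1 q.1.unpair.2 1 q.2 s s)).bind fun s =>
    (Nat.rfind fun t => Part.some (Φ.massTest q.1.unpair.1 q.1.unpair.2 4 q.2 t s)).map fun t =>
      Nat.pair q.1.unpair.2 (Nat.pair t s)

theorem partrec_searchTime (Φ : Machine) : Partrec Φ.searchTime := by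
  have hy : Computable fun q : ℕ × ℕ => q.1.unpair := Computable.unpair.comp Computable.fst
  have hw := Computable.fst.comp hy
  have hk := Computable.snd.comp hy
  have h1 := Φ.computable_massTest 1 (hw.comp (Computable.fst (β := ℕ))) (hk.comp Computable.fst)
    (Computable.snd.comp Computable.fst) Computable.snd Computable.snd
  have hf : Computable fun q : ((ℕ × ℕ) × ℕ) × ℕ => q.1.1 := Computable.fst.comp Computable.fst
  have h2 := Φ.computable_massTest 4 (hw.comp hf) (hk.comp hf) (Computable.snd.comp hf)
    Computable.snd (Computable.snd.comp Computable.fst)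
  have h3 := Primrec₂.natPair.to_comp.comp (hk.comp hf)
    (Primrec₂.natPair.to_comp.comp Computable.snd (Computable.snd.comp Computable.fst))
  exact (Partrec.rfind h1.partrec.to₂).bind ((Partrec.rfind h2.partrec.to₂).map h3.to₂).to₂

/-- Requests for the programs outside `Φ.haltSetBelow n t₀ s`, where `z` encodes `(k, t₀, s)`. -/
def freshRequests (Φ : Machine) (q : ℕ × ℕ) (p : List Bool) (t : ℕ) : Option (ℕ × ℕ) :=
  (Φ.step t p 0 q.2).bind fun v =>
    guardSome (decide (v + 1 ≤ 2 ^ q.2) &&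
      !(decide (Encodable.encode p + 1 ≤ q.1.unpair.2.unpair.2) &&
        (Φ.haltLength q.2 q.1.unpair.2.unpair.1 p).isSome))
      (p.length + 3 - q.1.unpair.1, v)

theorem freshRequests_eq_some {n k t₀ s t l v : ℕ} {p : List Bool} :
    Φ.freshRequests (Nat.pair k (Nat.pair t₀ s), n) p t = some (l, v) ↔
      Φ.step t p 0 n = some v ∧ (v < 2 ^ n ∧ p ∉ Φ.haltSetBelow n t₀ s) ∧
        p.length + 3 - k = l := by
  have h : (!(decide (Encodable.encode p < s) && (Φ.haltLength n t₀ p).isSome)) = true ↔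
      p ∉ Φ.haltSetBelow n t₀ s := by
    rw [Bool.not_eq_true', ← Bool.not_eq_true, Bool.and_eq_true, isSome_haltLength,
      decide_eq_true_eq]
    rfl
  simp only [freshRequests, Option.bind_eq_some_iff, guardSome_eq_some, Nat.unpair_pair,
    Bool.and_eq_true, h, Prod.mk.injEq, decide_eq_true_eq, Nat.add_one_le_iff]
  constructor
  · rintro ⟨v', h, hs, hl, rfl⟩
    exact ⟨h, hs, hl⟩
  · rintro ⟨h, hs, hl⟩
    exact ⟨v, h, hs, hl, rfl⟩

theorem computable_freshRequests (Φ : Machine) :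
    Computable fun q : (ℕ × ℕ) × List Bool × ℕ => Φ.freshRequests q.1 q.2.1 q.2.2 := by
  have hn : Computable fun q : (ℕ × ℕ) × List Bool × ℕ => q.1.2 := Computable.snd.comp Computable.fst
  have hp : Computable fun q : (ℕ × ℕ) × List Bool × ℕ => q.2.1 := Computable.fst.comp Computable.snd
  have hz : Computable fun q : (ℕ × ℕ) × List Bool × ℕ => q.1.1.unpair :=
    Computable.unpair.comp (Computable.fst.comp Computable.fst)
  have hts := Computable.unpair.comp (Computable.snd.comp hz)
  have hstep := Φ.computable_step_comp (Computable.snd.comp Computable.snd) hp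
    (Computable.const 0) hn
  have hold := (((Computable.succ.comp (Computable.encode.comp hp)).le
    (Computable.snd.comp hts)).band (Primrec.option_isSome.to_comp.comp
      (Φ.computable_haltLength hn (Computable.fst.comp hts) hp))).bnot
  have hv := (Computable.succ.comp (Computable.snd (α := (ℕ × ℕ) × List Bool × ℕ) (β := ℕ))).le
    (hn.comp Computable.fst).two_pow
  have hl := ((Computable.list_length.comp hp).add (Computable.const 3)).sub
    (Computable.fst.comp hz)
  have hg := (hv.band (hold.comp Computable.fst)).guardSome
    ((hl.comp Computable.fst).pair Computable.snd)
  exact Computable.option_bind hstep hg.to₂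

theorem POptimal.exists_C_le_of_fresh (hΦ : Φ.POptimal) : ∃ c, ∀ n k t₀ s,
    progWeight (Φ.haltSet n \ Φ.haltSetBelow n t₀ s) * 2 ^ k ≤ 2 ^ 3 →
    ∀ p x, x < 2 ^ n → Φ.Outputs p 0 n x → p ∉ Φ.haltSetBelow n t₀ s →
      k + Φ.C x (Nat.pair k (Nat.pair t₀ s)) n ≤ p.length + c := by
  obtain ⟨c, hc⟩ := hΦ.exists_C_le_of_requests Φ.computable_freshRequests (by
    rintro ⟨z, n⟩ p t t' ⟨l, v⟩ ht h
    rw [← Nat.pair_unpair z, ← Nat.pair_unpair z.unpair.2] at h ⊢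
    obtain ⟨hs, hi⟩ := freshRequests_eq_some.1 h
    exact freshRequests_eq_some.2 ⟨Φ.mono ht hs, hi⟩)
  refine ⟨c + 3, fun n k t₀ s hw p x hx ⟨t, ht⟩ hp => ?_⟩
  set S := Φ.haltSet n \ Φ.haltSetBelow n t₀ s
  have hinv (m : ℕ) : (2 : ℝ≥0∞) ^ m * 2⁻¹ ^ m = 1 := by
    rw [← mul_pow, ENNReal.mul_inv_cancel two_ne_zero ENNReal.ofNat_ne_top, one_pow]
  have hlen : ∀ q ∈ S, k ≤ q.length + 3 := by
    intro q hq
    have h : (2 : ℝ≥0∞) ^ k ≤ 2 ^ (q.length + 3) := by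
      calc (2 : ℝ≥0∞) ^ k = 2 ^ q.length * (2⁻¹ ^ q.length * 2 ^ k) := by
            rw [← mul_assoc, hinv, one_mul]
        _ ≤ 2 ^ q.length * (progWeight S * 2 ^ k) := by
            gcongr
            exact inv_two_pow_le_progWeight hq
        _ ≤ 2 ^ (q.length + 3) := by
            rw [pow_add]
            gcongr
    have h' : 2 ^ k ≤ 2 ^ (q.length + 3) := by exact_mod_cast h
    exact (Nat.pow_le_pow_iff_right one_lt_two).1 h'
  have hb : ∀ q t, lenWeight' ((Φ.freshRequests (Nat.pair k (Nat.pair t₀ s), n) q t).map Prod.fst) ≤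
      S.indicator (fun q => 2⁻¹ ^ q.length) q * (2 ^ k * 2⁻¹ ^ 3) := by
    intro q t
    cases h : Φ.freshRequests (Nat.pair k (Nat.pair t₀ s), n) q t with
    | none => simp [lenWeight'_none]
    | some a =>
      obtain ⟨hs, ⟨hv, hq⟩, hl⟩ := freshRequests_eq_some.1 h
      have hS : q ∈ S := ⟨⟨a.2, hv, t, hs⟩, hq⟩
      rw [Set.indicator_of_mem hS, Option.map_some, lenWeight'_some, ← hl]
      have hk : q.length + 3 = (q.length + 3 - k) + k := (Nat.sub_add_cancel (hlen q hS)).symm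
      calc (2⁻¹ : ℝ≥0∞) ^ (q.length + 3 - k)
          = 2⁻¹ ^ (q.length + 3 - k) * (2 ^ k * 2⁻¹ ^ k) := by rw [hinv, mul_one]
        _ = 2⁻¹ ^ (q.length + 3 - k + k) * 2 ^ k := by rw [pow_add]; ring
        _ = 2⁻¹ ^ q.length * (2 ^ k * 2⁻¹ ^ 3) := by rw [← hk, pow_add]; ring
        _ ≤ _ := le_rfl
  have hsum : ∑' q, S.indicator (fun q => (2⁻¹ : ℝ≥0∞) ^ q.length) q * (2 ^ k * 2⁻¹ ^ 3) ≤ 1 := by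
    rw [ENNReal.tsum_mul_right, ← mul_assoc, ← hinv 3]
    gcongr
    exact hw
  have h := hc _ n _ hb hsum p t _ x (freshRequests_eq_some.2 ⟨ht, ⟨hx, hp⟩, rfl⟩)
  have := hlen p ⟨⟨x, hx, t, ht⟩, hp⟩
  omega

theorem exists_mem_rfind {f : ℕ → Bool} (h : ∃ m, f m = true) :
    ∃ m ∈ Nat.rfind fun m => Part.some (f m), f m = true ∧ ∀ j, f j = true → m ≤ j :=
  ⟨Nat.find h, Nat.mem_rfind.2 ⟨Part.mem_some_iff.2 (Nat.find_spec h).symm,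
    fun hj => Part.mem_some_iff.2 (Bool.eq_false_iff.2 (Nat.find_min h hj)).symm⟩, Nat.find_spec h,
    fun _ hj => Nat.find_min' h hj⟩

theorem toReal_progWeight_diff {S T : Set (List Bool)} (h : T ⊆ S) (hS : progWeight S ≠ ⊤) :
    (progWeight (S \ T)).toReal = (progWeight S).toReal - (progWeight T).toReal := by
  have hT := ne_top_of_le_ne_top hS (progWeight_mono h)
  have hd := ne_top_of_le_ne_top hS (progWeight_mono (Set.sdiff_subset (s := S) (t := T)))
  rw [← progWeight_add_diff h, ENNReal.toReal_add hT hd]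
  ring

theorem exists_mem_searchTime (hΦ : Φ.PrefixFree) (n k : ℕ) :
    ∃ t₀ s, Nat.pair k (Nat.pair t₀ s) ∈ Φ.searchTime (Nat.pair (Φ.OmegaBits n k) k, n) ∧
      progWeight (Φ.haltSet n \ Φ.haltSetBelow n t₀ s) * 2 ^ k ≤ 2 ^ 3 ∧
      ∀ t, Φ.Omega n * 2 ^ k ≤ Φ.OmegaT n t * 2 ^ k + 2 → t₀ ≤ t := by
  set w := Φ.OmegaBits n k with hw_def
  have h2 : (0 : ℝ) < 2 ^ k := by positivity
  have hfin : progWeight (Φ.haltSet n) ≠ ⊤ :=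
    ne_top_of_le_ne_top ENNReal.one_ne_top (hΦ.progWeight_haltSet_le_one n)
  have hsub (t s : ℕ) : Φ.haltSetBelow n t s ⊆ Φ.haltSet n :=
    (haltSetBelow_subset n t s).trans (haltSetAt_subset n t)
  have hw1 : (w : ℝ) ≤ (progWeight (Φ.haltSet n)).toReal * 2 ^ k := by
    rw [← Omega_eq]
    exact Nat.floor_le (by rw [Omega_eq]; positivity)
  have hw2 : (progWeight (Φ.haltSet n)).toReal * 2 ^ k < w + 1 := by
    rw [← Omega_eq]
    exact Nat.lt_floor_add_one _
  obtain ⟨s, hs, hs1, -⟩ := exists_mem_rfind (f := fun s => Φ.massTest w k 1 n s s) (by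
    rcases Nat.eq_zero_or_pos w with h0 | hpos
    · exact ⟨0, massTest_eq_true.2 (by rw [h0, Nat.cast_zero]; positivity)⟩
    · have h1 : (1 : ℝ) ≤ w := by exact_mod_cast hpos
      have hlt : ENNReal.ofReal ((w - 1) / 2 ^ k) < progWeight (Φ.haltSet n) := by
        rw [ENNReal.ofReal_lt_iff_lt_toReal (div_nonneg (by linarith) h2.le) hfin,
          div_lt_iff₀ h2]
        linarith
      obtain ⟨s, hs⟩ := exists_lt_progWeight_haltSetBelow hlt
      refine ⟨s, massTest_eq_true.2 ?_⟩
      rw [ENNReal.ofReal_lt_iff_lt_toReal (div_nonneg (by linarith) h2.le)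
        (ne_top_of_le_ne_top hfin (progWeight_mono (hsub s s))), div_lt_iff₀ h2] at hs
      push_cast
      linarith)
  rw [massTest_eq_true] at hs1
  obtain ⟨t₀, ht₀, h4, hmin⟩ := exists_mem_rfind (f := fun t => Φ.massTest w k 4 n t s)
    ⟨s, massTest_eq_true.2 (by push_cast at hs1 ⊢; linarith)⟩
  rw [massTest_eq_true] at h4
  push_cast at hs1 h4
  refine ⟨t₀, s, ?_, ?_, fun t ht => hmin t (massTest_eq_true.2 ?_)⟩
  · simp only [searchTime, Part.mem_bind_iff, Part.mem_map_iff, Nat.unpair_pair]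
    exact ⟨s, hs, t₀, ht₀, rfl⟩
  · have hd := toReal_progWeight_diff (hsub t₀ s) hfin
    have hne := ne_top_of_le_ne_top hfin
      (progWeight_mono (Set.sdiff_subset (s := Φ.haltSet n) (t := Φ.haltSetBelow n t₀ s)))
    rw [← ENNReal.toReal_le_toReal (ENNReal.mul_ne_top hne (by finiteness)) (by finiteness),
      ENNReal.toReal_mul, hd]
    simp only [ENNReal.toReal_pow, ENNReal.toReal_ofNat]
    linarith
  · have hd : progWeight (Φ.haltSetAt n t \ Φ.haltSetBelow n t s) ≤
        progWeight (Φ.haltSet n \ Φ.haltSetBelow n s s) :=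
      progWeight_mono fun p hp => ⟨haltSetAt_subset n t hp.1, fun h => hp.2 ⟨h.1, hp.1⟩⟩
    have hd' := ENNReal.toReal_mono
      (ne_top_of_le_ne_top hfin (progWeight_mono Set.sdiff_subset)) hd
    rw [toReal_progWeight_diff (hsub s s) hfin, toReal_progWeight_diff (haltSetBelow_subset n t s)
      (ne_top_of_le_ne_top hfin (progWeight_mono (haltSetAt_subset n t)))] at hd'
    rw [Omega_eq, OmegaT_eq] at ht
    push_cast
    linarith [mul_le_mul_of_nonneg_right hd' h2.le]

theorem Omega_sub_OmegaT_tk_le (hΦ : Φ.PrefixFree) (n k : ℕ) :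
    Φ.Omega n - Φ.OmegaT n (Φ.tk n k) ≤ (2 : ℝ) ^ (-(k : ℤ)) := by
  refine Nat.sInf_mem (s := {t | Φ.Omega n - Φ.OmegaT n t ≤ (2 : ℝ) ^ (-(k : ℤ))}) ?_
  have hε : (0 : ℝ) < 2 ^ (-(k : ℤ)) := by positivity
  rcases le_or_gt (Φ.Omega n) (2 ^ (-(k : ℤ))) with h | h
  · refine ⟨0, ?_⟩
    have : 0 ≤ Φ.OmegaT n 0 := by rw [OmegaT_eq]; positivity
    simp only [Set.mem_ofPred_eq]
    linarith
  · have hfin : progWeight (Φ.haltSet n) ≠ ⊤ :=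
      ne_top_of_le_ne_top ENNReal.one_ne_top (hΦ.progWeight_haltSet_le_one n)
    have hlt : ENNReal.ofReal (Φ.Omega n - 2 ^ (-(k : ℤ))) < progWeight (Φ.haltSet n) := by
      rw [ENNReal.ofReal_lt_iff_lt_toReal (by linarith) hfin, ← Omega_eq]
      linarith
    obtain ⟨s, hs⟩ := exists_lt_progWeight_haltSetBelow hlt
    refine ⟨s, ?_⟩
    have h1 := hs.trans_le (progWeight_mono (haltSetBelow_subset n s s))
    rw [ENNReal.ofReal_lt_iff_lt_toReal (by linarith)
      (ne_top_of_le_ne_top hfin (progWeight_mono (haltSetAt_subset n s))), ← OmegaT_eq] at h1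
    simp only [Set.mem_ofPred_eq]
    linarith

theorem POptimal.mdepth_add_C_pair_le (hΦ : Φ.POptimal) (d : ℕ) : ∃ c, ∀ n, ∀ x < 2 ^ n,
    Φ.mdepth d n x + Φ.C x (Nat.pair (Φ.OmegaBits n (Φ.mdepth d n x)) (Φ.mdepth d n x)) n ≤
      Φ.C x 0 n + c := by
  obtain ⟨c₀, hc₀⟩ := hΦ.exists_C_le_of_partrec (g := fun _ => Part.some 0)
    (Computable.const 0).partrec
  obtain ⟨c₁, hc₁⟩ := hΦ.exists_C_le_of_partrec Φ.partrec_searchTime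
  obtain ⟨c₂, hc₂⟩ := hΦ.exists_C_le_of_fresh
  refine ⟨c₀ + c₁ + c₂, fun n x hx => ?_⟩
  rcases Nat.eq_zero_or_pos (Φ.mdepth d n x) with h0 | hpos
  · rw [h0]
    have := hc₀ (Nat.pair (Φ.OmegaBits n 0) 0) n 0 x (Part.mem_some 0)
    omega
  · set k := Φ.mdepth d n x with hk
    obtain ⟨p, hp, hl⟩ := hΦ.2.1.exists_shortestProg x 0 n
    obtain ⟨t₀, s, hz, hw, hmin⟩ := exists_mem_searchTime hΦ.1 n k
    have hstep : Φ.step (Φ.tk n (k - 1)) p 0 n ≠ some x := fun h =>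
      Nat.notMem_of_lt_sInf (Nat.sub_lt hpos one_pos) ⟨p, by omega, h⟩
    have hle := hmin (Φ.tk n (k - 1)) (by
      have h := Omega_sub_OmegaT_tk_le hΦ.1 n (k - 1)
      have h2 : (2 : ℝ) ^ (-((k - 1 : ℕ) : ℤ)) * 2 ^ k = 2 := by
        obtain ⟨m, hm⟩ : ∃ m, k = m + 1 := ⟨k - 1, by omega⟩
        rw [hm, Nat.add_sub_cancel, zpow_neg, zpow_natCast, pow_succ]
        field_simp
      have := mul_le_mul_of_nonneg_right h (by positivity : (0 : ℝ) ≤ 2 ^ k)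
      linarith)
    have hfresh : p ∉ Φ.haltSetBelow n t₀ s := by
      rintro ⟨-, v, -, hv⟩
      obtain rfl := Outputs.unique hp ⟨t₀, hv⟩
      exact hstep (Φ.mono hle hv)
    have h1 := hc₁ _ n _ x hz
    have h2 := hc₂ n k t₀ s hw p x hx hp hfresh
    omega

end Machine

end Auxiliary

/-- `K(x|n) = k_x + K(x|Ω^{n,k_x},n) ± (2 log k_x + O(1))`. -/
theorem stmt_3 (Φ : Machine) (hΦ : Φ.POptimal) (d : ℕ) :
    ∃ c : ℕ, ∀ n : ℕ, ∀ x < 2 ^ n,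
      Nat.dist (Φ.C x 0 n)
          (Φ.mdepth d n x +
            Φ.C x (Nat.pair (Φ.OmegaBits n (Φ.mdepth d n x)) (Φ.mdepth d n x)) n) ≤
        2 * Nat.log 2 (Φ.mdepth d n x) + c := by
  obtain ⟨c₁, hc₁⟩ := hΦ.C_le_add_C_pair
  obtain ⟨c₂, hc₂⟩ := hΦ.mdepth_add_C_pair_le d
  refine ⟨c₁ + c₂, fun n x hx => ?_⟩
  have h1 := hc₁ n (Φ.mdepth d n x) _ x (Machine.OmegaBits_le hΦ.1 n _)
  have h2 := hc₂ n x hx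
  unfold Nat.dist
  omega
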